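/- There exists a countably infinite acyclic oriented graph D₃ such that: (a) every finite acyclic triangle-free oriented graph embeds into D₃, and every countably infinite acyclic triangle-free oriented graph of order type ω embeds into D₃; and (b) every finite acyclic triangle-free oriented graph A has finite big Ramsey degree in D₃, i.e., there exists a positive integer T such that for every k ≥ 2 and every coloring χ of the set of embeddings of A into D₃ with k colors there is an embedding w of D₃ into itself such that {χ(w ∘ f) : f an embedding of A into D₃} has at most T elements. -/

import Mathlib

/-- An oriented graph: an irreflexive binary relation `r` with
`r x y → ¬ r y x`. -/
def IsOrientedGraph {A : Type} (r : A → A → Prop) : Prop :=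
  (∀ x, ¬ r x x) ∧ ∀ x y, r x y → ¬ r y x

/-- Acyclic: no directed cycle, i.e. the transitive closure is irreflexive. -/
def IsAcyclic {A : Type} (r : A → A → Prop) : Prop :=
  ∀ x, ¬ Relation.TransGen r x x

/-- There is a linear order of order type `ω` on the vertices extending `r`. -/
def AcyclicOfOrderTypeOmega {A : Type} (r : A → A → Prop) : Prop :=
  ∃ e : A ≃ ℕ, ∀ x y, r x y → e x < e y

/-- Triangle-free: does not embed the oriented graph `1 → 2`, `1 → 3`, `2 → 3`. -/
def OTriangleFree {A : Type} (r : A → A → Prop) : Prop :=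
  ¬ ∃ x y z : A, r x y ∧ r x z ∧ r y z

/-- An embedding of oriented graphs: an injective map preserving and
reflecting the arrow relation. -/
def OEmb {A B : Type} (rA : A → A → Prop) (rB : B → B → Prop) (f : A → B) : Prop :=
  Function.Injective f ∧ ∀ x y, rA x y ↔ rB (f x) (f y)

open Filter

theorem exists_good_idempotent {X : Type*} [Semigroup X] [TopologicalSpace X] [CompactSpace X]
    [T2Space X] (hc : ∀ r : X, Continuous (· * r)) (B L I : Set X)
    (hBc : IsClosed B) (hBB : ∀ x ∈ B, ∀ y ∈ B, x * y ∈ B)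
    (hLB : L ⊆ B) (hLc : IsClosed L) (hLn : L.Nonempty) (hLr : ∀ x ∈ L, ∀ y ∈ B, x * y ∈ L)
    (hIB : I ⊆ B) (hIc : IsClosed I) (hIn : I.Nonempty) (hIl : ∀ x ∈ B, ∀ y ∈ I, x * y ∈ I) :
    ∃ e, e ∈ L ∧ e ∈ I ∧ e * e = e ∧
      ∀ U ∈ B, (U * e) * (U * e) = U * e → e * (U * e) = e := by
  let S : Set (Set X) := {N | IsClosed N ∧ N.Nonempty ∧ ∀ x ∈ B, ∀ y ∈ N, x * y ∈ N}
  obtain ⟨N, hNI, hN⟩ : ∃ N', N' ⊆ I ∧ Minimal (· ∈ S) N' := by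
    refine zorn_superset_nonempty S ?_ I ⟨hIc, hIn, hIl⟩
    intro c hcs hch hcn
    refine ⟨⋂₀ c, ⟨isClosed_sInter fun t ht => (hcs ht).1, ?_, ?_⟩,
      fun s hs => Set.sInter_subset_of_mem hs⟩
    · convert!
        @IsCompact.nonempty_iInter_of_directed_nonempty_isCompact_isClosed _ _ _ hcn.coe_sort
          ((↑) : c → Set X) ?_ ?_ ?_ ?_
      · exact Set.sInter_eq_iInter
      · exact DirectedOn.directed_val (IsChain.directedOn hch.symm)
      exacts [fun i => (hcs i.prop).2.1, fun i => (hcs i.prop).1.isCompact,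
        fun i => (hcs i.prop).1]
    · intro x hx y hy
      rw [Set.mem_sInter] at hy ⊢
      exact fun t ht => (hcs ht).2.2 x hx y (hy t ht)
  obtain ⟨hNc, ⟨p, hp⟩, hNl⟩ := hN.prop
  have hpB : p ∈ B := hIB (hNI hp)
  obtain ⟨e, ⟨z, hz, rfl⟩, hee⟩ := exists_idempotent_in_compact_subsemigroup hc ((· * p) '' L)
    (hLn.image _) (hLc.isCompact.image (hc p)) (by
      rintro _ ⟨x, hx, rfl⟩ _ ⟨y, hy, rfl⟩
      exact ⟨x * p * y, hLr _ (hLr _ hx _ hpB) _ (hLB hy), mul_assoc _ _ _⟩)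
  simp only at hee ⊢
  have heN : z * p ∈ N := hNl _ (hLB hz) _ hp
  refine ⟨z * p, hLr _ hz _ hpB, hNI heN, hee, ?_⟩
  intro U hU hV
  set e := z * p
  have hVN : U * e ∈ N := hNl _ hU _ heN
  have himg : (· * (U * e)) '' B = N := by
    apply hN.eq_of_subset
    · refine ⟨(hc _).isClosedMap _ hBc, ⟨_, ⟨p, hpB, rfl⟩⟩, ?_⟩
      rintro x hx _ ⟨y, hy, rfl⟩
      exact ⟨x * y, hBB _ hx _ hy, mul_assoc _ _ _⟩
    · rintro _ ⟨y, hy, rfl⟩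
      exact hNl _ hy _ hVN
  have : e ∈ (· * (U * e)) '' B := himg ▸ heN
  obtain ⟨y, hy, hye⟩ := this
  simp only at hye
  calc e * (U * e) = (y * (U * e)) * (U * e) := by rw [hye]
    _ = y * ((U * e) * (U * e)) := mul_assoc _ _ _
    _ = e := by rw [hV, hye]

attribute [local instance] Ultrafilter.mul Ultrafilter.semigroup

/-- words with letters at most `n` -/
def wordsLE (n : ℕ) : Set (FreeMonoid ℕ) := {x | ∀ a ∈ FreeMonoid.toList x, a ≤ n}

/-- words with letters at most `n` starting with `n` -/
def wordsLEStart (n : ℕ) : Set (FreeMonoid ℕ) :=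
  {x | ∃ v : List ℕ, FreeMonoid.toList x = n :: v ∧ ∀ a ∈ v, a ≤ n}

/-- collapse letters above `n` to `j` -/
def collapse (n j : ℕ) : ℕ → ℕ := fun i => if i ≤ n then i else j

theorem ultrafilter_map_mul {M N : Type*} [Monoid M] [Monoid N] (φ : M →* N)
    (U V : Ultrafilter M) : (U * V).map φ = U.map φ * V.map φ := by
  apply Ultrafilter.coe_inj.mp
  apply Filter.ext'
  intro p
  rw [Ultrafilter.eventually_mul]
  simp only [Ultrafilter.coe_map, Filter.eventually_map]
  rw [Ultrafilter.eventually_mul]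
  simp

theorem ultrafilter_isClosed_mem {M : Type*} (s : Set M) : IsClosed {U : Ultrafilter M | s ∈ U} :=
  ultrafilter_isClosed_basic s

theorem ultrafilter_mul_mem {M : Type*} [Mul M] {s t u : Set M} (h : ∀ x ∈ s, ∀ y ∈ t, x * y ∈ u)
    {U V : Ultrafilter M} (hU : s ∈ U) (hV : t ∈ V) : u ∈ U * V := by
  change ∀ᶠ x in ↑(U * V), x ∈ u
  rw [Ultrafilter.eventually_mul]
  filter_upwards [hU] with x hx
  filter_upwards [hV] with y hy using h x hx y hy

theorem wordsLE_mul {n : ℕ} : ∀ x ∈ wordsLE n, ∀ y ∈ wordsLE n, x * y ∈ wordsLE n := by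
  intro x hx y hy a ha
  rw [FreeMonoid.toList_mul, List.mem_append] at ha
  exact ha.elim (hx a) (hy a)

theorem wordsLEStart_mul {n : ℕ} :
    ∀ x ∈ wordsLEStart n, ∀ y ∈ wordsLE n, x * y ∈ wordsLEStart n := by
  rintro x ⟨v, hv, hvn⟩ y hy
  refine ⟨v ++ FreeMonoid.toList y, ?_, ?_⟩
  · rw [FreeMonoid.toList_mul, hv]; rfl
  · intro a ha
    rw [List.mem_append] at ha
    exact ha.elim (hvn a) (hy a)

theorem wordsLEStart_subset {n : ℕ} : wordsLEStart n ⊆ wordsLE n := by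
  rintro x ⟨v, hv, hvn⟩ a ha
  rw [hv, List.mem_cons] at ha
  rcases ha with rfl | ha
  · exact le_rfl
  · exact hvn a ha

/-- the properties of the ultrafilters in the sequence -/
def GoodUlt (n : ℕ) (e : Ultrafilter (FreeMonoid ℕ)) : Prop :=
  wordsLEStart n ∈ e ∧ e * e = e ∧
    ∀ U : Ultrafilter (FreeMonoid ℕ), wordsLE n ∈ U → (U * e) * (U * e) = U * e → e * (U * e) = e

theorem exists_goodUlt (n : ℕ) (I : Set (Ultrafilter (FreeMonoid ℕ)))
    (hIB : I ⊆ {U | wordsLE n ∈ U}) (hIc : IsClosed I) (hIn : I.Nonempty)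
    (hIl : ∀ x ∈ {U : Ultrafilter (FreeMonoid ℕ) | wordsLE n ∈ U}, ∀ y ∈ I, x * y ∈ I) :
    ∃ e, e ∈ I ∧ GoodUlt n e := by
  obtain ⟨e, h1, h2, h3, h4⟩ := exists_good_idempotent
    (X := Ultrafilter (FreeMonoid ℕ)) Ultrafilter.continuous_mul_left
    {U | wordsLE n ∈ U} {U | wordsLEStart n ∈ U} I
    (ultrafilter_isClosed_mem _)
    (fun x hx y hy => ultrafilter_mul_mem wordsLE_mul hx hy)
    (fun U hU => mem_of_superset hU wordsLEStart_subset)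
    (ultrafilter_isClosed_mem _)
    ⟨pure (FreeMonoid.ofList [n]), by
      change wordsLEStart n ∈ (pure _ : Ultrafilter _)
      rw [Ultrafilter.mem_pure]
      exact ⟨[], rfl, by simp⟩⟩
    (fun x hx y hy => ultrafilter_mul_mem wordsLEStart_mul hx hy)
    hIB hIc hIn hIl
  exact ⟨e, h2, h1, h3, h4⟩

theorem collapse_fix {n j : ℕ} {x : FreeMonoid ℕ} (hx : x ∈ wordsLE n) :
    FreeMonoid.map (collapse n j) x = x := by
  apply FreeMonoid.toList.injective
  rw [FreeMonoid.toList_map]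
  conv_rhs => rw [← List.map_id (FreeMonoid.toList x)]
  apply List.map_congr_left
  intro a ha
  simp [collapse, hx a ha]

theorem collapse_mem {n j : ℕ} (hj : j ≤ n) (x : FreeMonoid ℕ) :
    FreeMonoid.map (collapse n j) x ∈ wordsLE n := by
  intro a ha
  rw [FreeMonoid.toList_map, List.mem_map] at ha
  obtain ⟨b, -, rfl⟩ := ha
  unfold collapse
  split_ifs <;> assumption

theorem exists_goodUlt_step (n : ℕ) (e : Ultrafilter (FreeMonoid ℕ)) (he : GoodUlt n e) :
    ∃ e', GoodUlt (n + 1) e' ∧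
      ∀ j ≤ n, e * e'.map (FreeMonoid.map (collapse n j)) = e := by
  have hle : wordsLE n ⊆ wordsLE (n + 1) := fun x hx a ha => (hx a ha).trans (Nat.le_succ n)
  have hen : wordsLE n ∈ e := mem_of_superset he.1 wordsLEStart_subset
  have hen1 : wordsLE (n + 1) ∈ e := mem_of_superset hen hle
  obtain ⟨e', ⟨y, hy, rfl⟩, hg⟩ := exists_goodUlt (n + 1)
    ((· * e) '' {U : Ultrafilter (FreeMonoid ℕ) | wordsLE (n + 1) ∈ U})
    (by
      rintro _ ⟨y, hy, rfl⟩
      exact ultrafilter_mul_mem wordsLE_mul hy hen1)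
    ((Ultrafilter.continuous_mul_left e).isClosedMap _ (ultrafilter_isClosed_mem _))
    ⟨_, ⟨e, hen1, rfl⟩⟩
    (by
      rintro x hx _ ⟨y, hy, rfl⟩
      exact ⟨x * y, ultrafilter_mul_mem wordsLE_mul hx hy, mul_assoc _ _ _⟩)
  refine ⟨_, hg, ?_⟩
  intro j hj
  simp only at hg ⊢
  have hidem := hg.2.1
  have hre : e.map (FreeMonoid.map (collapse n j)) = e := by
    apply Ultrafilter.coe_inj.mp
    rw [Ultrafilter.coe_map]
    conv_rhs => rw [← Filter.map_id (f := (e : Filter (FreeMonoid ℕ)))]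
    apply Filter.map_congr
    filter_upwards [hen] with x hx using collapse_fix hx
  have hmap := ultrafilter_map_mul (FreeMonoid.map (collapse n j)) y e
  rw [hre] at hmap
  have hidem2 := congrArg (Ultrafilter.map (FreeMonoid.map (collapse n j))) hidem
  rw [ultrafilter_map_mul, hmap] at hidem2
  rw [hmap]
  refine he.2.2 _ ?_ hidem2
  rw [Ultrafilter.mem_map]
  exact Filter.univ_mem' (fun x => collapse_mem hj x)

theorem exists_ult_seq : ∃ e : ℕ → Ultrafilter (FreeMonoid ℕ), ∀ n,
    wordsLEStart n ∈ e n ∧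
      ∀ j ≤ n, e n * (e (n + 1)).map (FreeMonoid.map (collapse n j)) = e n := by
  obtain ⟨e0, -, h0⟩ := exists_goodUlt 0 {U | wordsLE 0 ∈ U} subset_rfl
    (ultrafilter_isClosed_mem _)
    ⟨pure 1, by
      change wordsLE 0 ∈ (pure _ : Ultrafilter _)
      rw [Ultrafilter.mem_pure]
      intro a ha
      simp at ha⟩
    (fun x hx y hy => ultrafilter_mul_mem wordsLE_mul hx hy)
  choose! st hst1 hst2 using exists_goodUlt_step
  let e : ℕ → Ultrafilter (FreeMonoid ℕ) := fun n => Nat.rec e0 (fun n x => st n x) n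
  have hgood : ∀ n, GoodUlt n (e n) := by
    intro n
    induction n with
    | zero => exact h0
    | succ n ih => exact hst1 n _ ih
  exact ⟨e, fun n => ⟨(hgood n).1, hst2 n _ (hgood n)⟩⟩

/-- An infinite-parameter word: `f n` is the first occurrence of the parameter `n`,
`g j` is the parameter at position `j`. -/
structure PWord where
  f : ℕ → ℕ
  g : ℕ → ℕ
  hg : ∀ n, g (f n) = n
  hlt : ∀ n j, j < f n → g j < n

namespace PWord

theorem f_strictMono (W : PWord) : StrictMono W.f := by
  intro n m hnm
  by_contra h
  rcases (not_lt.mp h).lt_or_eq with h | h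
  · have := W.hlt _ _ h
    rw [W.hg] at this
    omega
  · have := congrArg W.g h
    rw [W.hg, W.hg] at this
    omega

/-- substitution of a word -/
def app (W : PWord) {α : Type*} (u : List α) : List α :=
  List.ofFn (fun j : Fin (W.f u.length) => u[W.g j]'(W.hlt _ _ j.2))

@[simp] theorem length_app (W : PWord) {α : Type*} (u : List α) :
    (W.app u).length = W.f u.length := by simp [app]

theorem getElem_app (W : PWord) {α : Type*} (u : List α) (j : ℕ) (h : j < (W.app u).length) :
    (W.app u)[j] = u[W.g j]'(W.hlt _ _ (by simpa using h)) := by simp [app]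

theorem app_map (W : PWord) {α β : Type*} (φ : α → β) (u : List α) :
    W.app (u.map φ) = (W.app u).map φ := by
  apply List.ext_getElem
  · simp
  · intro i h1 h2
    simp [getElem_app]

/-- composition -/
def comp (W W' : PWord) : PWord where
  f := W.f ∘ W'.f
  g := W'.g ∘ W.g
  hg n := by simp [W.hg, W'.hg]
  hlt n j h := W'.hlt _ _ (W.hlt _ _ h)

theorem app_comp (W W' : PWord) {α : Type*} (u : List α) :
    (W.comp W').app u = W.app (W'.app u) := by
  apply List.ext_getElem
  · simp [comp]
  · intro i h1 h2
    simp [getElem_app, comp]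

/-- identity -/
def one : PWord where
  f := id
  g := id
  hg _ := rfl
  hlt _ _ h := h

theorem app_mem (W : PWord) {α : Type*} (u : List α) (b : α) (h : b ∈ W.app u) : b ∈ u := by
  obtain ⟨i, hi, rfl⟩ := List.mem_iff_getElem.mp h
  rw [getElem_app]
  exact List.getElem_mem _

theorem app_append_cons (W : PWord) {α : Type*} (l : List α) (a : α) (l' : List α) :
    ∃ r, W.app (l ++ a :: l') = W.app l ++ a :: r ∧ ∀ b ∈ r, b ∈ l ++ a :: l' := by
  have hlen : W.f l.length < W.f (l ++ a :: l').length := W.f_strictMono (by simp)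
  have key : W.app (l ++ a :: l') =
      W.app l ++ a :: (W.app (l ++ a :: l')).drop (W.f l.length + 1) := by
    apply List.ext_getElem
    · simp only [length_app, List.length_append, List.length_cons, List.length_drop] at hlen ⊢
      omega
    · intro i h1 h2
      rcases lt_trichotomy i (W.f l.length) with h | h | h
      · have h3 := W.hlt _ _ h
        rw [List.getElem_append_left (by simpa using h)]
        rw [getElem_app, getElem_app, List.getElem_append_left h3]
      · subst h
        rw [List.getElem_append_right (by simp)]
        simp [getElem_app, W.hg]
      · rw [List.getElem_append_right (by simpa using h.le)]
        obtain ⟨d, rfl⟩ : ∃ d, i = W.f l.length + 1 + d := ⟨i - (W.f l.length + 1), by omega⟩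
        have e1 : W.f l.length + 1 + d - (W.app l).length = d + 1 := by simp; omega
        simp only [e1, List.getElem_cons_succ, List.getElem_drop]
  refine ⟨_, key, fun b hb => W.app_mem _ _ (List.mem_of_mem_drop hb)⟩

end PWord

/-- evaluation of a word at position `i` -/
def evw (Q : List ℕ) : ℕ → ℕ := fun i => Q.getD i 0

theorem ult_limit {M C : Type*} [Finite C] (e : Ultrafilter M) (F : M → C) :
    ∃ c, ∀ᶠ x in e, F x = c := by
  obtain ⟨c, hc⟩ := (e.map F).eq_pure_of_finite
  refine ⟨c, ?_⟩
  have : ({c} : Set C) ∈ e.map F := by rw [hc]; exact Ultrafilter.mem_pure.mpr rfl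
  exact this

theorem exists_pword_of_seq (w : ℕ → List ℕ) (h0 : w 0 = [])
    (hs : ∀ n, ∃ v : List ℕ, w (n + 1) = w n ++ n :: v ∧ ∀ a ∈ v, a ≤ n) :
    ∃ W : PWord, ∀ Q : List ℕ, W.app Q = (w Q.length).map (evw Q) := by
  have hpre : ∀ n m, n ≤ m → w n <+: w m := by
    intro n m h
    induction m, h using Nat.le_induction with
    | base => exact List.prefix_rfl
    | succ m h ih =>
      obtain ⟨v, hv, -⟩ := hs m
      exact ih.trans ⟨m :: v, hv.symm⟩
  have hlen : ∀ n, n ≤ (w n).length := by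
    intro n
    induction n with
    | zero => simp
    | succ n ih =>
      obtain ⟨v, hv, -⟩ := hs n
      rw [hv, List.length_append, List.length_cons]
      omega
  have hlet : ∀ n, ∀ a ∈ w n, a < n := by
    intro n
    induction n with
    | zero => simp [h0]
    | succ n ih =>
      obtain ⟨v, hv, hv2⟩ := hs n
      intro a ha
      rw [hv, List.mem_append, List.mem_cons] at ha
      rcases ha with ha | rfl | ha
      · have := ih a ha; omega
      · omega
      · have := hv2 a ha; omega
  let g : ℕ → ℕ := fun j => (w (j + 1)).getD j 0
  have hgw : ∀ n j (h : j < (w n).length), g j = (w n)[j] := by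
    intro n j h
    have hj : j < (w (j + 1)).length := hlen (j + 1)
    change (w (j + 1)).getD j 0 = _
    rw [List.getD_eq_getElem _ _ hj]
    rcases le_total n (j + 1) with hh | hh
    · exact ((hpre _ _ hh).getElem h).symm
    · exact (hpre _ _ hh).getElem hj
  refine ⟨⟨fun n => (w n).length, g, ?_, ?_⟩, ?_⟩
  · intro n
    obtain ⟨v, hv, hv2⟩ := hs n
    rw [hgw (n + 1) _ (by rw [hv]; simp)]
    simp [hv]
  · intro n j h
    rw [hgw n j h]
    exact hlet n _ (List.getElem_mem _)
  · intro Q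
    apply List.ext_getElem
    · simp
    · intro i h1 h2
      have h3 : i < (w Q.length).length := by simpa using h2
      have h4 := hlet _ _ (List.getElem_mem h3)
      rw [PWord.getElem_app]
      simp only [hgw _ i h3, List.getElem_map, evw]
      rw [List.getD_eq_getElem _ _ h4]

theorem finite_words (n : ℕ) : {Q : List ℕ | Q.length = n ∧ ∀ b ∈ Q, b < n}.Finite := by
  apply ((List.finite_length_eq (Fin n) n).image (List.map Fin.val)).subset
  rintro Q ⟨h1, h2⟩
  refine ⟨Q.attach.map (fun b => ⟨b.1, h2 b.1 b.2⟩), by simp [h1], ?_⟩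
  rw [List.map_map]
  exact List.attach_map_subtype_val Q

theorem exists_stable {C : Type*} [Finite C] (χ : List ℕ → C) :
    ∃ W : PWord, ∀ (Q : List ℕ) (a : ℕ), (∀ b ∈ Q, b < Q.length) → a ∈ Q →
      χ (W.app (Q ++ [a])) = χ (W.app Q) := by
  obtain ⟨e, he⟩ := exists_ult_seq
  have hL : ∀ (n : ℕ) (w Q : List ℕ), ∃ c, ∀ᶠ x in (e n : Filter (FreeMonoid ℕ)),
      χ ((w ++ FreeMonoid.toList x).map (evw Q)) = c := fun n w Q => ult_limit _ _
  choose L hL using hL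
  have step : ∀ (n : ℕ) (w : List ℕ), (∀ a ∈ w, a < n) → ∃ v : List ℕ, (∀ a ∈ v, a ≤ n) ∧
      ∀ Q : List ℕ, Q.length = n + 1 → (∀ b ∈ Q, b < n + 1) →
        χ ((w ++ n :: v).map (evw Q)) = L n w Q ∧
        ∀ a ∈ Q, L (n + 1) (w ++ n :: v) (Q ++ [a]) = L n w Q := by
    intro n w hwn
    have hev : ∀ Q ∈ {Q : List ℕ | Q.length = n + 1 ∧ ∀ b ∈ Q, b < n + 1},
        ∀ᶠ x in (e n : Filter (FreeMonoid ℕ)),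
        ∀ a ∈ Q, L (n + 1) (w ++ FreeMonoid.toList x) (Q ++ [a]) = L n w Q := by
      rintro Q ⟨hQl, hQ⟩
      have : ∀ a ∈ {a | a ∈ Q}, ∀ᶠ x in (e n : Filter (FreeMonoid ℕ)),
          L (n + 1) (w ++ FreeMonoid.toList x) (Q ++ [a]) = L n w Q := by
        intro a ha
        obtain ⟨j, hj, rfl⟩ := List.mem_iff_getElem.mp ha
        have h1 := hL n w Q
        rw [← (he n).2 j (by omega), Ultrafilter.eventually_mul] at h1
        have h4 : ∀ᶠ z in (e n : Filter (FreeMonoid ℕ)), z ∈ wordsLE n :=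
          mem_of_superset (he n).1 wordsLEStart_subset
        filter_upwards [h1, h4] with x hx hxn
        rw [Ultrafilter.coe_map, Filter.eventually_map] at hx
        have h2 := hL (n + 1) (w ++ FreeMonoid.toList x) (Q ++ [Q[j]])
        have h3 : ∀ᶠ y in (e (n + 1) : Filter (FreeMonoid ℕ)), y ∈ wordsLE (n + 1) :=
          mem_of_superset (he (n + 1)).1 wordsLEStart_subset
        obtain ⟨y, hy1, hy2, hyn⟩ := (hx.and (h2.and h3)).exists
        rw [← hy2, ← hy1]
        have hsmall : ∀ i ≤ n, evw (Q ++ [Q[j]]) i = evw Q i := by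
          intro i hi
          unfold evw
          rw [List.getD_append _ _ _ _ (by omega)]
        rw [FreeMonoid.toList_mul, FreeMonoid.toList_map, List.append_assoc]
        simp only [List.map_append, List.map_map]
        congr 2
        · apply List.map_congr_left
          intro i hi
          exact hsmall i (hwn i hi).le
        · congr 1
          · apply List.map_congr_left
            intro i hi
            exact hsmall i (hxn i hi)
          · apply List.map_congr_left
            intro i hi
            have hi2 := hyn i hi
            simp only [Function.comp, collapse]
            split_ifs with h
            · exact hsmall i h
            · obtain rfl : i = n + 1 := by omega
              simp [evw, ← hQl, hj]
      have hfin : {a | a ∈ Q}.Finite := List.finite_toSet Q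
      exact (Filter.eventually_all_finite hfin).mpr this
    have hev2 := (Filter.eventually_all_finite (finite_words (n + 1))).mpr hev
    have hev3 := (Filter.eventually_all_finite (finite_words (n + 1))).mpr
      (fun Q _ => hL n w Q)
    have hev4 : ∀ᶠ x in (e n : Filter (FreeMonoid ℕ)), x ∈ wordsLEStart n := (he n).1
    obtain ⟨x, hx2, hx3, v, hv, hvn⟩ := (hev2.and (hev3.and hev4)).exists
    rw [hv] at hx2 hx3
    exact ⟨v, hvn, fun Q h1 h2 => ⟨hx3 Q ⟨h1, h2⟩, hx2 Q ⟨h1, h2⟩⟩⟩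
  choose! v hv1 hv2 using step
  let w : ℕ → List ℕ := fun n => Nat.rec [] (fun n x => x ++ n :: v n x) n
  have hw : ∀ n, w (n + 1) = w n ++ n :: v n (w n) := fun n => rfl
  have hwl : ∀ n, ∀ a ∈ w n, a < n := by
    intro n
    induction n with
    | zero => intro a ha; exact absurd ha List.not_mem_nil
    | succ n ih =>
      intro a ha
      rw [hw, List.mem_append, List.mem_cons] at ha
      rcases ha with ha | rfl | ha
      · have := ih a ha; omega
      · omega
      · have := hv1 n _ ih a ha; omega
  obtain ⟨W, hW⟩ := exists_pword_of_seq w rfl (fun n => ⟨v n (w n), hw n, hv1 n _ (hwl n)⟩)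
  refine ⟨W, ?_⟩
  intro Q a hQ ha
  obtain ⟨n, hn⟩ : ∃ n, Q.length = n + 1 := by
    cases Q with
    | nil => simp at ha
    | cons b l => exact ⟨l.length, rfl⟩
  have hQa : (Q ++ [a]).length = n + 1 + 1 := by simp [hn]
  rw [hn] at hQ
  rw [hW, hW, hQa, hn, hw (n + 1), (hv2 (n + 1) (w (n + 1)) (hwl (n + 1)) (Q ++ [a]) hQa ?_).1]
  · rw [hw n, (hv2 n (w n) (hwl n) Q hn hQ).1]
    exact (hv2 n (w n) (hwl n) Q hn hQ).2 a ha
  · intro b hb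
    rw [List.mem_append, List.mem_singleton] at hb
    rcases hb with hb | rfl
    · exact (hQ b hb).trans (Nat.lt_succ_self _)
    · exact (hQ b ha).trans (Nat.lt_succ_self _)

/-- rigid words with `k` letters -/
def Rig : ℕ → List ℕ → Prop
  | 0, P => P = []
  | k + 1, P => ∃ P₀ u, Rig k P₀ ∧ (∀ a ∈ u, a ≤ k) ∧ P = P₀ ++ k :: u

theorem Rig.mem_iff {k : ℕ} : ∀ {P : List ℕ}, Rig k P → ∀ a, a ∈ P ↔ a < k := by
  induction k with
  | zero => intro P h a; cases h; simp
  | succ k ih =>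
    rintro P ⟨P₀, u, h, hu, rfl⟩ a
    rw [List.mem_append, List.mem_cons, ih h]
    constructor
    · rintro (h | rfl | h)
      · omega
      · omega
      · have := hu a h; omega
    · intro h
      rcases Nat.lt_succ_iff_lt_or_eq.mp h with h | h
      · exact Or.inl h
      · exact Or.inr (Or.inl h)

theorem Rig.le_length {k : ℕ} : ∀ {P : List ℕ}, Rig k P → k ≤ P.length := by
  induction k with
  | zero => intro P h; simp
  | succ k ih =>
    rintro P ⟨P₀, u, h, hu, rfl⟩
    have := ih h
    simp
    omega

theorem Rig.app {k : ℕ} (W : PWord) : ∀ {P : List ℕ}, Rig k P → Rig k (W.app P) := by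
  induction k with
  | zero =>
    intro P h
    cases h
    have : W.f 0 = 0 := by
      by_contra h
      exact Nat.not_lt_zero _ (W.hlt 0 0 (Nat.pos_of_ne_zero h))
    exact List.eq_nil_of_length_eq_zero (by simp [this])
  | succ k ih =>
    rintro P ⟨P₀, u, h, hu, rfl⟩
    obtain ⟨r, hr, hr2⟩ := W.app_append_cons P₀ k u
    refine ⟨_, r, ih h, ?_, hr⟩
    intro a ha
    have := (Rig.mem_iff (k := k + 1) ⟨P₀, u, h, hu, rfl⟩ a).mp (hr2 a ha)
    omega

theorem dual_ramsey (k : ℕ) : ∀ {C : Type} [Finite C] (χ : List ℕ → C),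
    ∃ (W : PWord) (c : C), ∀ P, Rig k P → χ (W.app P) = c := by
  induction k with
  | zero => intro C _ χ; exact ⟨PWord.one, χ (PWord.one.app []), fun P h => by cases h; rfl⟩
  | succ k ih =>
    intro C _ χ
    obtain ⟨W, hW⟩ := exists_stable χ
    obtain ⟨W', c, hc⟩ := ih (fun P => χ (W.app (P ++ [k])))
    refine ⟨W.comp W', c, ?_⟩
    rintro P ⟨P₀, u, h, hu, rfl⟩
    rw [PWord.app_comp]
    obtain ⟨P₁, r, h1, hr, heq⟩ : ∃ P₁ r, W'.app P₀ = P₁ ∧ (∀ b ∈ r, b ≤ k) ∧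
        W'.app (P₀ ++ k :: u) = P₁ ++ k :: r := by
      obtain ⟨r, hr, hr2⟩ := W'.app_append_cons P₀ k u
      refine ⟨_, r, rfl, ?_, hr⟩
      intro a ha
      have := (Rig.mem_iff (k := k + 1) ⟨P₀, u, h, hu, rfl⟩ a).mp (hr2 a ha)
      omega
    have hR : Rig k P₁ := h1 ▸ h.app W'
    rw [heq, ← hc P₀ h, h1]
    clear heq
    induction r using List.reverseRecOn with
    | nil => rfl
    | append_singleton r a ihr =>
      have hr' : ∀ b ∈ r, b ≤ k := fun b hb => hr b (by simp [hb])
      have hRig : Rig (k + 1) (P₁ ++ k :: r) := ⟨P₁, r, hR, hr', rfl⟩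
      have ha : a ≤ k := hr a (by simp)
      rw [← ihr hr', show P₁ ++ k :: (r ++ [a]) = (P₁ ++ k :: r) ++ [a] by simp]
      apply hW
      · intro b hb
        have := (hRig.mem_iff b).mp hb
        have := hRig.le_length
        omega
      · exact (hRig.mem_iff a).mpr (by omega)

theorem dual_ramsey_le (K : ℕ) {C : ℕ → Type} [∀ k, Finite (C k)] (χ : ∀ k, List ℕ → C k) :
    ∃ (W : PWord) (c : ∀ k, C k), ∀ k < K, ∀ P, Rig k P → χ k (W.app P) = c k := by
  induction K with
  | zero => exact ⟨PWord.one, fun k => χ k [], fun k hk => absurd hk (Nat.not_lt_zero _)⟩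
  | succ K ih =>
    obtain ⟨W, c, hW⟩ := ih
    obtain ⟨W', c', hW'⟩ := dual_ramsey K (fun P => χ K (W.app P))
    refine ⟨W.comp W', Function.update c K c', ?_⟩
    intro k hk P hP
    rw [PWord.app_comp]
    rcases Nat.lt_succ_iff_lt_or_eq.mp hk with h | rfl
    · rw [Function.update_of_ne h.ne]
      exact hW k h _ (hP.app W')
    · rw [Function.update_self]
      exact hW' P hP

theorem PWord.getElem?_app (W : PWord) {α : Type*} (u : List α) (j : ℕ) (h : j < W.f u.length) :
    (W.app u)[j]? = u[W.g j]? := by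
  have h2 := W.hlt _ _ h
  rw [List.getElem?_eq_getElem (by simpa using h), List.getElem?_eq_getElem h2, W.getElem_app]

/-- The arrow relation of the universal triangle-free acyclic graph on finite binary words. -/
def relD (u v : List Bool) : Prop :=
  u.length < v.length ∧ v[u.length]? = some true ∧
    ∀ i < u.length, ¬ (u[i]? = some true ∧ v[i]? = some true)

theorem relD_app (W : PWord) : OEmb relD relD W.app := by
  constructor
  · intro u v h
    have hl : u.length = v.length := by
      have := congrArg List.length h
      rw [W.length_app, W.length_app] at this
      exact W.f_strictMono.injective this
    apply List.ext_getElem? 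
    intro i
    by_cases hi : i < u.length
    · have h1 := W.getElem?_app u (W.f i) (W.f_strictMono hi)
      have h2 := W.getElem?_app v (W.f i) (W.f_strictMono (hl ▸ hi))
      rw [W.hg] at h1 h2
      rw [← h1, ← h2, h]
    · rw [List.getElem?_eq_none (by omega), List.getElem?_eq_none (by omega)]
  · intro u v
    unfold relD
    rw [W.length_app, W.length_app, W.f_strictMono.lt_iff_lt]
    refine and_congr_right fun hl => ?_
    rw [W.getElem?_app v _ (W.f_strictMono hl), W.hg]
    refine and_congr_right fun _ => ?_
    constructor
    · intro h j hj
      have hj2 := W.hlt _ _ hj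
      rw [W.getElem?_app u j hj, W.getElem?_app v j (hj.trans (W.f_strictMono hl))]
      exact h _ hj2
    · intro h i hi
      have := h (W.f i) (W.f_strictMono hi)
      rwa [W.getElem?_app u _ (W.f_strictMono hi),
        W.getElem?_app v _ (W.f_strictMono (hi.trans hl)), W.hg] at this

open Classical in
theorem universal_aux {A : Type} (r : A → A → Prop) (ι : A → ℕ) (hι : Function.Injective ι)
    (hr : ∀ x y, r x y → ι x < ι y) (ht : OTriangleFree r) :
    ∃ f : A → List Bool, OEmb r relD f := by
  let φ : A → List Bool := fun x =>
    (List.range (ι x)).map (fun i => decide (∃ z, ι z = i ∧ r z x))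
  have hlen : ∀ x, (φ x).length = ι x := fun x => by simp [φ]
  have hget : ∀ x y, ι y < ι x → ((φ x)[ι y]? = some true ↔ r y x) := by
    intro x y h
    have : (φ x)[ι y]? = some (decide (∃ z, ι z = ι y ∧ r z x)) := by
      simp [φ, List.getElem?_range h]
    rw [this]
    simp only [Option.some.injEq, decide_eq_true_eq]
    constructor
    · rintro ⟨z, hz, h⟩
      rwa [← hι hz]
    · exact fun h => ⟨y, rfl, h⟩
  have hget2 : ∀ x i, (φ x)[i]? = some true → ∃ z, ι z = i ∧ r z x := by
    intro x i h
    simp only [φ, List.getElem?_map, Option.map_eq_some_iff, decide_eq_true_eq] at h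
    obtain ⟨j, hj, h⟩ := h
    have : i = j := by
      obtain ⟨h1, h2⟩ := List.getElem?_eq_some_iff.mp hj
      simpa using h2
    rw [this]; exact h
  refine ⟨φ, ?_, ?_⟩
  · intro x y h
    apply hι
    rw [← hlen, ← hlen, h]
  · intro x y
    unfold relD
    rw [hlen, hlen]
    constructor
    · intro h
      refine ⟨hr _ _ h, (hget y x (hr _ _ h)).mpr h, ?_⟩
      rintro i hi ⟨h1, h2⟩
      obtain ⟨z, hz, hzx⟩ := hget2 _ _ h1
      obtain ⟨z', hz', hzy⟩ := hget2 _ _ h2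
      have : z = z' := hι (hz.trans hz'.symm)
      subst this
      exact ht ⟨z, x, y, hzx, hzy, h⟩
    · rintro ⟨h1, h2, -⟩
      exact (hget y x h1).mp h2

theorem exists_rank {A : Type} [Finite A] (r : A → A → Prop) (hr : IsAcyclic r) :
    ∃ ι : A → ℕ, Function.Injective ι ∧ ∀ x y, r x y → ι x < ι y := by
  obtain ⟨N, ⟨e⟩⟩ := Finite.exists_equiv_fin A
  let h : A → ℕ := fun x => {y | Relation.TransGen r y x}.ncard
  refine ⟨fun x => h x * N + e x, ?_, ?_⟩
  · intro x y hxy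
    have hx := (e x).2
    have hy := (e y).2
    simp only at hxy
    apply e.injective
    apply Fin.ext
    have := congrArg (· % N) hxy
    simpa [Nat.mul_add_mod', Nat.mod_eq_of_lt hx, Nat.mod_eq_of_lt hy] using this
  · intro x y hxy
    have hx := (e x).2
    have hlt : h x < h y := by
      apply Set.ncard_lt_ncard _ (Set.toFinite _)
      refine ⟨fun z hz => Relation.TransGen.tail hz hxy, fun hsub => ?_⟩
      exact hr x (hsub (Relation.TransGen.single hxy : Relation.TransGen r x y))
    have : (h x + 1) * N ≤ h y * N := Nat.mul_le_mul_right N hlt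
    have h3 : (h x + 1) * N = h x * N + N := by ring
    simp only
    omega

theorem Rig.snoc {k : ℕ} {P : List ℕ} (h : Rig k P) {i : ℕ} (hi : i < k) : Rig k (P ++ [i]) := by
  cases k with
  | zero => omega
  | succ k =>
    obtain ⟨P₀, u, h0, hu, rfl⟩ := h
    refine ⟨P₀, u ++ [i], h0, ?_, by simp⟩
    intro a ha
    rw [List.mem_append, List.mem_singleton] at ha
    rcases ha with ha | rfl
    · exact hu a ha
    · omega

theorem exists_rig_factor {α : Type} [Nonempty α] (w : List α) :
    ∃ (k : ℕ) (P : List ℕ) (τ : ℕ → α), Rig k P ∧ w = P.map τ ∧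
      ∀ i < k, ∀ j < k, τ i = τ j → i = j := by
  induction w using List.reverseRecOn with
  | nil => exact ⟨0, [], fun _ => Classical.arbitrary α, rfl, rfl, by simp⟩
  | append_singleton w a ih =>
    obtain ⟨k, P, τ, hP, rfl, hinj⟩ := ih
    by_cases ha : a ∈ P.map τ
    · obtain ⟨i, hi, rfl⟩ := List.mem_map.mp ha
      exact ⟨k, P ++ [i], τ, hP.snoc ((hP.mem_iff i).mp hi), by simp, hinj⟩
    · refine ⟨k + 1, P ++ [k], Function.update τ k a, ⟨P, [], hP, by simp, rfl⟩, ?_, ?_⟩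
      · rw [List.map_append]
        congr 1
        · apply List.map_congr_left
          intro i hi
          have := (hP.mem_iff i).mp hi
          rw [Function.update_of_ne this.ne]
        · simp
      · have hne : ∀ i < k, τ i ≠ a := fun i hi h =>
          ha (List.mem_map.mpr ⟨i, (hP.mem_iff i).mpr hi, h⟩)
        intro i hi j hj hij
        rcases Nat.lt_succ_iff_lt_or_eq.mp hi with hi | rfl <;>
        rcases Nat.lt_succ_iff_lt_or_eq.mp hj with hj | rfl
        · rw [Function.update_of_ne hi.ne, Function.update_of_ne hj.ne] at hij
          exact hinj i hi j hj hij
        · rw [Function.update_of_ne hi.ne, Function.update_self] at hij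
          exact absurd hij (hne i hi)
        · rw [Function.update_of_ne hj.ne, Function.update_self] at hij
          exact absurd hij.symm (hne j hj)
        · rfl

/-- decoding a word of columns -/
def decCols {A : Type} (w : List (A → Option Bool)) (v : A) : List Bool :=
  ((w.map (fun c => c v)).takeWhile Option.isSome).filterMap id

/-- the word of columns of a tuple of words -/
def encCols {A : Type} (F : A → List Bool) (N : ℕ) : List (A → Option Bool) :=
  (List.range N).map (fun i v => (F v)[i]?)

theorem encCols_map {A : Type} (F : A → List Bool) (N : ℕ) (v : A) (h : (F v).length ≤ N) :
    (encCols F N).map (fun c => c v) =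
      (F v).map some ++ List.replicate (N - (F v).length) none := by
  apply List.ext_getElem
  · simp [encCols]; omega
  · intro i h1 h2
    simp only [encCols, List.getElem_map, List.getElem_range, List.map_map]
    by_cases hi : i < (F v).length
    · rw [List.getElem_append_left (by simpa using hi)]
      simp [hi]
    · rw [List.getElem_append_right (by simpa using hi)]
      simp
      omega

theorem decCols_app {A : Type} (W : PWord) (F : A → List Bool) (N : ℕ) (v : A)
    (h : (F v).length ≤ N) : decCols (W.app (encCols F N)) v = W.app (F v) := by
  unfold decCols
  rw [← W.app_map, encCols_map F N v h]
  have hall : ∀ a ∈ (W.app (F v)).map some, Option.isSome a = true := by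
    intro a ha
    obtain ⟨b, -, rfl⟩ := List.mem_map.mp ha
    rfl
  rcases N - (F v).length with _ | d
  · simp only [List.replicate_zero, List.append_nil]
    rw [W.app_map, List.takeWhile_eq_self_iff.mpr hall]
    simp
  · rw [List.replicate_succ]
    obtain ⟨s, hs, -⟩ := W.app_append_cons ((F v).map some) none (List.replicate d none)
    rw [hs, W.app_map, List.takeWhile_append_of_pos hall]
    simp

theorem big_ramsey {A : Type} [Finite A] (rA : A → A → Prop) :
    ∃ T : ℕ, 0 < T ∧ ∀ k, 2 ≤ k →
      ∀ χ : {f : A → List Bool // OEmb rA relD f} → Fin k,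
        ∃ w : {g : List Bool → List Bool // OEmb relD relD g},
          (χ '' {p | ∃ f₀ : {f : A → List Bool // OEmb rA relD f},
            p.val = w.val ∘ f₀.val}).ncard ≤ T := by
  classical
  let α := A → Option Bool
  let K := Nat.card α + 1
  let I := Σ k : Fin K, (Fin k → α)
  refine ⟨Nat.card I + 1, Nat.succ_pos _, ?_⟩
  intro q hq χ
  let ext : ∀ k, (Fin k → α) → ℕ → α := fun k τ i => if h : i < k then τ ⟨i, h⟩ else fun _ => none
  let col : ∀ k, List ℕ → ((Fin k → α) → Fin q) := fun k P τ =>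
    if h : OEmb rA relD (decCols (P.map (ext k τ))) then χ ⟨_, h⟩ else ⟨0, by omega⟩
  obtain ⟨W, c, hW⟩ := dual_ramsey_le K col
  refine ⟨⟨W.app, relD_app W⟩, ?_⟩
  have hsub : (χ '' {p | ∃ f₀ : {f : A → List Bool // OEmb rA relD f},
      p.val = W.app ∘ f₀.val}) ⊆ Set.range (fun s : I => c s.1 s.2) := by
    rintro _ ⟨p, ⟨⟨F, hF⟩, hp⟩, rfl⟩
    simp only at hp
    obtain ⟨N, hN⟩ : ∃ N, ∀ v, (F v).length ≤ N := by
      obtain ⟨N, hN⟩ := (Set.finite_range (fun v => (F v).length)).bddAbove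
      exact ⟨N, fun v => hN ⟨v, rfl⟩⟩
    obtain ⟨k, P, τ, hP, hw, hinj⟩ := exists_rig_factor (encCols F N)
    have hk : k < K := by
      have hi : Function.Injective (fun i : Fin k => τ i) := by
        intro i j hij
        exact Fin.ext (hinj i i.2 j j.2 hij)
      have := Nat.card_le_card_of_injective _ hi
      rw [Nat.card_fin] at this
      exact Nat.lt_succ_of_le this
    refine ⟨⟨⟨k, hk⟩, fun i => τ i⟩, ?_⟩
    simp only
    have hmap : P.map (ext k (fun i => τ i)) = encCols F N := by
      rw [hw]
      apply List.map_congr_left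
      intro i hi
      have := (hP.mem_iff i).mp hi
      simp [ext, this]
    have hdec : decCols ((W.app P).map (ext k (fun i => τ i))) = p.val := by
      rw [hp, ← W.app_map, hmap]
      funext v
      exact decCols_app W F N v (hN v)
    rw [← hW k hk P hP]
    simp only [col]
    rw [dif_pos (by rw [hdec]; exact p.2)]
    congr 1
    exact Subtype.ext hdec
  calc _ ≤ (Set.range (fun s : I => c s.1 s.2)).ncard := Set.ncard_le_ncard hsub (Set.toFinite _)
    _ ≤ Nat.card I := by
      rw [← Nat.card_coe_set_eq]
      exact Finite.card_range_le _
    _ ≤ _ := Nat.le_succ _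

theorem relD_acyclic : IsAcyclic relD := by
  have : ∀ x y, Relation.TransGen relD x y → x.length < y.length := by
    intro x y h
    induction h with
    | single h => exact h.1
    | tail _ h ih => exact ih.trans h.1
  exact fun x h => lt_irrefl _ (this x x h)

theorem stmt11 :
    ∃ (D : Type) (rD : D → D → Prop),
      Countable D ∧ Infinite D ∧ IsOrientedGraph rD ∧ IsAcyclic rD ∧
      -- (a) universality
      (∀ (A : Type) (rA : A → A → Prop), Finite A → IsOrientedGraph rA →
        IsAcyclic rA → OTriangleFree rA → ∃ f : A → D, OEmb rA rD f) ∧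
      (∀ (A : Type) (rA : A → A → Prop), Countable A → Infinite A →
        IsOrientedGraph rA → AcyclicOfOrderTypeOmega rA → OTriangleFree rA →
        ∃ f : A → D, OEmb rA rD f) ∧
      -- (b) finite big Ramsey degrees
      (∀ (A : Type) (rA : A → A → Prop), Finite A → IsOrientedGraph rA →
        IsAcyclic rA → OTriangleFree rA →
        ∃ T : ℕ, 0 < T ∧ ∀ k, 2 ≤ k →
          ∀ χ : {f : A → D // OEmb rA rD f} → Fin k,
            ∃ w : {g : D → D // OEmb rD rD g},
              (χ '' {p | ∃ f₀ : {f : A → D // OEmb rA rD f},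
                p.val = w.val ∘ f₀.val}).ncard ≤ T) := by

  refine ⟨List Bool, relD, inferInstance, inferInstance,
    ⟨fun x h => lt_irrefl _ h.1, fun x y h h' => lt_asymm h.1 h'.1⟩, relD_acyclic, ?_, ?_, ?_⟩
  · intro A rA _ _ hac ht
    obtain ⟨ι, h1, h2⟩ := exists_rank rA hac
    exact universal_aux rA ι h1 h2 ht
  · rintro A rA _ _ _ ⟨e, he⟩ ht
    exact universal_aux rA e e.injective he ht
  · intro A rA _ _ _ _
    exact big_ramsey rA
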